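/- Trivial bundle (smash product) decomposition: Let k be a field, B a Hopf algebra over k with antipode S, (A,ρ) a right B-comodule algebra, and γ : B → A a B-comodule algebra homomorphism, i.e. a k-algebra homomorphism with ρ ∘ γ = (γ ⊗ id_B) ∘ Δ. Then the k-linear map A^{coB} ⊗ B → A, v ⊗ b ↦ v·γ(b), is bijective, and it intertwines the coaction id ⊗ Δ on A^{coB} ⊗ B with ρ on A, i.e. ρ(v·γ(b)) = Σ v·γ(b₍₁₎) ⊗ b₍₂₎. -/

import Mathlib

open scoped TensorProduct

/-- `(A, ρ)` is a right `B`-comodule algebra. -/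
structure IsComoduleAlgebra (k : Type*) [CommRing k]
    (B : Type*) [Ring B] [Bialgebra k B]
    {A : Type*} [Ring A] [Algebra k A]
    (ρ : A →ₐ[k] A ⊗[k] B) : Prop where
  coassoc : ∀ a : A,
      TensorProduct.assoc k A B B (TensorProduct.map ρ.toLinearMap LinearMap.id (ρ a))
        = TensorProduct.map LinearMap.id (Coalgebra.comul (R := k) (A := B)) (ρ a)
  counit : ∀ a : A,
      TensorProduct.rid k A
        (TensorProduct.map LinearMap.id (Coalgebra.counit (R := k) (A := B)) (ρ a)) = a

/-- The coinvariants `A^{co B} = {a | ρ a = a ⊗ 1}` of a right `B`-comodule algebra,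
as a `k`-submodule of `A`. -/
def coinvariants (k : Type*) [CommRing k] {B : Type*} [Ring B] [Bialgebra k B]
    {A : Type*} [Ring A] [Algebra k A] (ρ : A →ₐ[k] A ⊗[k] B) : Submodule k A where
  carrier := {a | ρ a = a ⊗ₜ[k] (1 : B)}
  add_mem' := by
    intro a b ha hb
    simp only [Set.mem_setOf_eq] at *
    rw [map_add, ha, hb, TensorProduct.add_tmul]
  zero_mem' := by
    simp only [Set.mem_setOf_eq, map_zero, TensorProduct.zero_tmul]
  smul_mem' := by
    intro c a ha
    simp only [Set.mem_setOf_eq] at *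
    rw [map_smul, ha, TensorProduct.smul_tmul']

section Helpers
open TensorProduct

/-- Convolution-type action. -/
noncomputable def starr {k X B C : Type*} [CommRing k] [AddCommGroup X] [Module k X]
    [Ring B] [Algebra k B] [Ring C] [Algebra k C]
    (δ : X →ₗ[k] X ⊗[k] B) (f : X →ₗ[k] C) (g : B →ₗ[k] C) : X →ₗ[k] C :=
  LinearMap.mul' k C ∘ₗ TensorProduct.map f g ∘ₗ δ

variable {k X B C D : Type*} [CommRing k] [AddCommGroup X] [Module k X]
    [Ring B] [Bialgebra k B] [Ring C] [Algebra k C] [Ring D] [Algebra k D]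

theorem starr_assoc (δ : X →ₗ[k] X ⊗[k] B)
    (hδ : ∀ a, TensorProduct.assoc k X B B (TensorProduct.map δ LinearMap.id (δ a))
        = TensorProduct.map LinearMap.id (Coalgebra.comul (R := k) (A := B)) (δ a))
    (f : X →ₗ[k] C) (g h : B →ₗ[k] C) :
    starr δ (starr δ f g) h = starr δ f (starr Coalgebra.comul g h) := by
  ext a
  have h1 : ∀ t : X ⊗[k] B, LinearMap.mul' k C (TensorProduct.map (starr δ f g) h t) =
      LinearMap.mul' k C (TensorProduct.map f (LinearMap.mul' k C ∘ₗ TensorProduct.map g h)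
        (TensorProduct.assoc k X B B (TensorProduct.map δ LinearMap.id t))) := by
    intro t
    induction t with
    | zero => simp
    | add x y hx hy => simp only [map_add, hx, hy]
    | tmul x b =>
      simp only [map_tmul, starr, LinearMap.comp_apply, LinearMap.mul'_apply, LinearMap.id_apply]
      induction δ x with
      | zero => simp
      | add x y hx hy => simp only [map_add, add_mul, add_tmul, hx, hy]
      | tmul y c => simp [mul_assoc]
  have h2 : ∀ t : X ⊗[k] B, TensorProduct.map f (starr Coalgebra.comul g h) t =
      TensorProduct.map f (LinearMap.mul' k C ∘ₗ TensorProduct.map g h)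
        (TensorProduct.map LinearMap.id (Coalgebra.comul (R := k) (A := B)) t) := by
    intro t
    induction t with
    | zero => simp
    | add x y hx hy => simp only [map_add, hx, hy]
    | tmul x b => simp [starr]
  change LinearMap.mul' k C (TensorProduct.map (starr δ f g) h (δ a)) =
    LinearMap.mul' k C (TensorProduct.map f (starr Coalgebra.comul g h) (δ a))
  rw [h1, hδ, h2]

theorem starr_comp (δ : X →ₗ[k] X ⊗[k] B) (φ : C →ₐ[k] D) (f : X →ₗ[k] C) (g : B →ₗ[k] C) :
    φ.toLinearMap ∘ₗ starr δ f g = starr δ (φ.toLinearMap ∘ₗ f) (φ.toLinearMap ∘ₗ g) := by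
  ext a
  simp only [starr, LinearMap.comp_apply]
  induction δ a with
  | zero => simp
  | add x y hx hy => simp only [map_add, hx, hy]
  | tmul y c => simp

/-- Convolution unit. -/
noncomputable def unitt (k B C : Type*) [CommRing k]
    [Ring B] [Bialgebra k B] [Ring C] [Algebra k C] : B →ₗ[k] C :=
  Algebra.linearMap k C ∘ₗ Coalgebra.counit

theorem starr_unit (δ : X →ₗ[k] X ⊗[k] B)
    (hδ : ∀ a, TensorProduct.rid k X
        (TensorProduct.map LinearMap.id (Coalgebra.counit (R := k) (A := B)) (δ a)) = a)
    (f : X →ₗ[k] C) : starr δ f (unitt k B C) = f := by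
  ext a
  conv_rhs => rw [← hδ a]
  simp only [starr, LinearMap.comp_apply]
  induction δ a with
  | zero => simp
  | add x y hx hy => simp only [map_add, hx, hy]
  | tmul y c => simp [unitt, Algebra.smul_def, Algebra.commutes]

theorem unit_starr (f : B →ₗ[k] C) :
    starr (Coalgebra.comul (R := k)) (unitt k B C) f = f := by
  ext a
  have h := congrArg (fun t => LinearMap.mul' k C (TensorProduct.map (Algebra.linearMap k C) f t))
    (Coalgebra.rTensor_counit_comul (R := k) a)
  simp only [map_tmul, LinearMap.mul'_apply, Algebra.linearMap_apply, map_one, one_mul] at h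
  rw [← h]
  simp only [starr, LinearMap.comp_apply]
  induction Coalgebra.comul (R := k) a with
  | zero => simp
  | add x y hx hy => simp only [map_add, hx, hy]
  | tmul y c => simp [unitt]

theorem comul_hδ (a : B) : TensorProduct.assoc k B B B
    (TensorProduct.map Coalgebra.comul LinearMap.id (Coalgebra.comul (R := k) a))
        = TensorProduct.map LinearMap.id (Coalgebra.comul (R := k) (A := B)) (Coalgebra.comul a) :=
  Coalgebra.coassoc_apply a

theorem comul_hε (a : B) : TensorProduct.rid k B
        (TensorProduct.map LinearMap.id (Coalgebra.counit (R := k) (A := B))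
          (Coalgebra.comul a)) = a := by
  have := Coalgebra.lTensor_counit_comul (R := k) a
  rw [LinearMap.lTensor] at this
  rw [this]; simp

variable {H : Type*} [Ring H] [HopfAlgebra k H]

theorem anti_left : starr (Coalgebra.comul (R := k)) (HopfAlgebra.antipode k) LinearMap.id
    = unitt k H H := by
  ext a
  exact HopfAlgebra.mul_antipode_rTensor_comul_apply a

theorem anti_right : starr (Coalgebra.comul (R := k)) LinearMap.id (HopfAlgebra.antipode k)
    = unitt k H H := by
  ext a
  exact HopfAlgebra.mul_antipode_lTensor_comul_apply a

theorem comp_unit (φ : C →ₐ[k] D) : φ.toLinearMap ∘ₗ unitt k B C = unitt k B D := by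
  ext a; simp [unitt]

theorem alg_left (φ : H →ₐ[k] C) : starr (Coalgebra.comul (R := k))
    (φ.toLinearMap ∘ₗ HopfAlgebra.antipode k) φ.toLinearMap = unitt k H C := by
  rw [← comp_unit φ, ← anti_left, starr_comp]; rfl

theorem alg_right (φ : H →ₐ[k] C) : starr (Coalgebra.comul (R := k))
    φ.toLinearMap (φ.toLinearMap ∘ₗ HopfAlgebra.antipode k) = unitt k H C := by
  rw [← comp_unit φ, ← anti_right, starr_comp]; rfl

theorem conv_cancel (G u i F r : B →ₗ[k] C)
    (h1 : starr (Coalgebra.comul (R := k)) G u = unitt k B C)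
    (h2 : starr (Coalgebra.comul (R := k)) u i = r)
    (h3 : starr (Coalgebra.comul (R := k)) r F = unitt k B C) :
    starr (Coalgebra.comul (R := k)) i F = G := by
  have a1 := starr_assoc (X := B) (B := B) (Coalgebra.comul (R := k))
    (comul_hδ (k := k) (B := B)) G u (starr Coalgebra.comul i F)
  have a2 := starr_assoc (X := B) (B := B) (Coalgebra.comul (R := k))
    (comul_hδ (k := k) (B := B)) u i F
  have a3 := starr_unit (X := B) (B := B) (Coalgebra.comul (R := k))
    (comul_hε (k := k) (B := B)) G
  rw [h1, unit_starr, ← a2, h2, h3, a3] at a1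
  exact a1

end Helpers

set_option maxHeartbeats 1000000 in
/-- **Trivial bundle (smash product) decomposition.** Let `B` be a Hopf algebra over a
field `k`, `(A, ρ)` a right `B`-comodule algebra, and `γ : B → A` a `B`-comodule algebra
homomorphism.  Then the `k`-linear map `A^{co B} ⊗ B → A`, `v ⊗ b ↦ v·γ(b)`, is
bijective, and it intertwines the coaction `id ⊗ Δ` on `A^{co B} ⊗ B` with `ρ`:
`ρ(v·γ(b)) = Σ v·γ(b₍₁₎) ⊗ b₍₂₎`. -/
theorem trivial_bundle_decomposition
    {k : Type*} [Field k] {B : Type*} [Ring B] [HopfAlgebra k B]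
    {A : Type*} [Ring A] [Algebra k A]
    (ρ : A →ₐ[k] A ⊗[k] B) (hρ : IsComoduleAlgebra k B ρ)
    (γ : B →ₐ[k] A)
    (hγ : ∀ b : B, ρ (γ b) =
      TensorProduct.map γ.toLinearMap LinearMap.id (Coalgebra.comul (R := k) (A := B) b)) :
    Function.Bijective
      ((LinearMap.mul' k A) ∘ₗ
        TensorProduct.map (coinvariants k ρ).subtype γ.toLinearMap) ∧
    ∀ (v : coinvariants k ρ) (b : B),
      ρ ((v : A) * γ b) =
        TensorProduct.map
          ((LinearMap.mul' k A) ∘ₗ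
            TensorProduct.map (coinvariants k ρ).subtype γ.toLinearMap)
          LinearMap.id
          ((TensorProduct.assoc k (coinvariants k ρ) B B).symm
            (v ⊗ₜ[k] Coalgebra.comul (R := k) (A := B) b)) := by
  have hδ := hρ.coassoc
  have hε := hρ.counit
  set S := HopfAlgebra.antipode k (A := B) with hS
  let δ : A →ₗ[k] A ⊗[k] B := ρ.toLinearMap
  let ι : A →ₐ[k] A ⊗[k] B := Algebra.TensorProduct.includeLeft
  let i : B →ₐ[k] A ⊗[k] B := Algebra.TensorProduct.includeRight
  let P : A →ₗ[k] A := starr δ LinearMap.id (γ.toLinearMap ∘ₗ S)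
  have hρi : starr δ ι.toLinearMap i.toLinearMap = ρ.toLinearMap := by
    ext a
    change LinearMap.mul' k _ (TensorProduct.map _ _ (ρ a)) = ρ a
    induction ρ a with
    | zero => simp
    | add x y hx hy => simp only [map_add, hx, hy]
    | tmul y c => simp [ι, i]
  have hui : starr (Coalgebra.comul (R := k)) (ι.comp γ).toLinearMap i.toLinearMap
      = (ρ.comp γ).toLinearMap := by
    ext a
    change LinearMap.mul' k _ (TensorProduct.map _ _ (Coalgebra.comul (R := k) a)) = ρ (γ a)
    rw [hγ]
    induction Coalgebra.comul (R := k) a with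
    | zero => simp
    | add x y hx hy => simp only [map_add, hx, hy]
    | tmul y c => simp [ι, i]
  have hiF : starr (Coalgebra.comul (R := k)) i.toLinearMap ((ρ.comp γ).toLinearMap ∘ₗ S)
      = (ι.comp γ).toLinearMap ∘ₗ S := by
    have e1 := alg_left (k := k) (ι.comp γ)
    have e2 := alg_right (k := k) (ρ.comp γ)
    exact conv_cancel _ _ _ _ _ e1 hui e2
  have hP : ρ.toLinearMap ∘ₗ P = ι.toLinearMap ∘ₗ P := by
    change _ ∘ₗ starr _ _ _ = _ ∘ₗ starr _ _ _
    rw [starr_comp, starr_comp]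
    change starr δ ρ.toLinearMap ((ρ.comp γ).toLinearMap ∘ₗ S) =
      starr δ ι.toLinearMap ((ι.comp γ).toLinearMap ∘ₗ S)
    rw [← hiF, ← starr_assoc δ hδ, hρi]
  have hPmem : ∀ a, P a ∈ coinvariants k ρ := fun a => LinearMap.congr_fun hP a
  have hPγ : ∀ (v : coinvariants k ρ) (b : B),
      P ((v : A) * γ b) = Coalgebra.counit (R := k) b • (v : A) := by
    intro v b
    have hv : ρ (v : A) = (v : A) ⊗ₜ[k] (1 : B) := v.2
    have h0 := LinearMap.congr_fun (alg_right (k := k) γ) b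
    have h1 : P ((v : A) * γ b) = (v : A) * starr (Coalgebra.comul (R := k)) γ.toLinearMap
        (γ.toLinearMap ∘ₗ HopfAlgebra.antipode k) b := by
      change LinearMap.mul' k _ (TensorProduct.map _ _ (ρ ((v : A) * γ b))) =
        _ * LinearMap.mul' k _ (TensorProduct.map _ _ (Coalgebra.comul (R := k) b))
      rw [map_mul, hv, hγ]
      induction Coalgebra.comul (R := k) b with
      | zero => simp
      | add x y hx hy => simp only [map_add, mul_add, hx, hy]
      | tmul y c => simp [mul_assoc, S]
    rw [h1, h0]
    simp [unitt, Algebra.smul_def, Algebra.commutes]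
  have hint : ∀ (v : coinvariants k ρ) (b : B),
      ρ ((v : A) * γ b) =
        TensorProduct.map
          ((LinearMap.mul' k A) ∘ₗ
            TensorProduct.map (coinvariants k ρ).subtype γ.toLinearMap)
          LinearMap.id
          ((TensorProduct.assoc k (coinvariants k ρ) B B).symm
            (v ⊗ₜ[k] Coalgebra.comul (R := k) (A := B) b)) := by
    intro v b
    have hv : ρ (v : A) = (v : A) ⊗ₜ[k] (1 : B) := v.2
    rw [map_mul, hv, hγ]
    induction Coalgebra.comul (R := k) b with
    | zero => simp
    | add x y hx hy => simp only [map_add, mul_add, TensorProduct.tmul_add, hx, hy]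
    | tmul y c => simp
  refine ⟨?_, hint⟩
  let P' : A →ₗ[k] coinvariants k ρ := P.codRestrict _ hPmem
  have hP'γ : ∀ (v : coinvariants k ρ) (b : B),
      P' ((v : A) * γ b) = Coalgebra.counit (R := k) b • v :=
    fun v b => Subtype.ext (hPγ v b)
  refine Function.bijective_iff_has_inverse.2
    ⟨fun a => TensorProduct.map P' LinearMap.id (ρ a), ?_, ?_⟩
  · intro t
    induction t with
    | zero => simp
    | add x y hx hy => simp only [map_add] at hx hy ⊢; rw [hx, hy]
    | tmul v b =>
      simp only [LinearMap.comp_apply, TensorProduct.map_tmul, LinearMap.mul'_apply,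
        Submodule.subtype_apply, AlgHom.toLinearMap_apply]
      rw [hint]
      have h := congrArg (fun t => v ⊗ₜ[k] (TensorProduct.lid k B t))
        (Coalgebra.rTensor_counit_comul (R := k) b)
      simp only [TensorProduct.lid_tmul, one_smul] at h
      rw [← h]
      induction Coalgebra.comul (R := k) b with
      | zero => simp
      | add x y hx hy => simp only [map_add, TensorProduct.tmul_add, hx, hy]
      | tmul y c => simp [hP'γ, TensorProduct.smul_tmul]
  · intro a
    have h1 : starr δ P γ.toLinearMap = LinearMap.id := by
      change starr δ (starr δ _ _) _ = _
      rw [starr_assoc δ hδ, alg_left, starr_unit δ hε]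
    have h2 : ∀ t : A ⊗[k] B, ((LinearMap.mul' k A) ∘ₗ
        TensorProduct.map (coinvariants k ρ).subtype γ.toLinearMap)
          (TensorProduct.map P' LinearMap.id t) =
        LinearMap.mul' k A (TensorProduct.map P γ.toLinearMap t) := by
      intro t
      induction t with
      | zero => simp
      | add x y hx hy => simp only [map_add, hx, hy]
      | tmul y c => simp [P']
    exact (h2 (ρ a)).trans (LinearMap.congr_fun h1 a)
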